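/- The pushforward of μ_s^{n+1} under the corner map Π : Mat(n+1, Q_p) → Mat(n, Q_p), sending a block matrix [[z11, z12],[z21, z22]] (with z11 of size n×n) to z11, equals μ_s^n. -/

import Mathlib

open MeasureTheory Matrix
open scoped ENNReal NNReal BigOperators

variable {p : ℕ} [Fact p.Prime]

noncomputable instance : MeasurableSpace ℚ_[p] := borel _
instance : BorelSpace ℚ_[p] := ⟨rfl⟩
noncomputable instance (n m : ℕ) : MeasurableSpace (Matrix (Fin n) (Fin m) ℚ_[p]) :=
  (inferInstance : MeasurableSpace (Fin n → Fin m → ℚ_[p]))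
instance (n m : ℕ) : BorelSpace (Matrix (Fin n) (Fin m) ℚ_[p]) :=
  (inferInstance : BorelSpace (Fin n → Fin m → ℚ_[p]))

/-- A matrix over `ℚ_[p]` lies in `GL(·, ℤ_p)`: it has integral entries and an
integral two-sided inverse. -/
def IsGLZp {m : Type*} [Fintype m] [DecidableEq m] (A : Matrix m m ℚ_[p]) : Prop :=
  (∀ i j, ‖A i j‖ ≤ 1) ∧ ∃ B : Matrix m m ℚ_[p],
    (∀ i j, ‖B i j‖ ≤ 1) ∧ A * B = 1 ∧ B * A = 1

/-- Smith normal form over `ℤ_p`: `z = A * diagonal d * B` with `A, B ∈ GL(n, ℤ_p)`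
and each diagonal entry `d j` equal to `0` or to a power `p^(-k_j)` of `p`. -/
def IsSmith {n : ℕ} (z : Matrix (Fin n) (Fin n) ℚ_[p])
    (A : Matrix (Fin n) (Fin n) ℚ_[p]) (d : Fin n → ℚ_[p])
    (B : Matrix (Fin n) (Fin n) ℚ_[p]) : Prop :=
  IsGLZp A ∧ IsGLZp B ∧ (∀ j, d j = 0 ∨ ∃ k : ℤ, d j = (p : ℚ_[p]) ^ (-k)) ∧
    z = A * Matrix.diagonal d * B

open Classical in
/-- `γ(z) = ∏_{k_j > 0} p^{k_j}`, computed from a Smith normal form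
`z = A diag(p^{-k_1},…,p^{-k_n}) B`: indeed `max(‖d j‖, 1) = p^{k_j}` when `k_j > 0`
and `= 1` otherwise. -/
noncomputable def gammaFn {n : ℕ} (z : Matrix (Fin n) (Fin n) ℚ_[p]) : ℝ :=
  if h : ∃ A d B, IsSmith z A d B then ∏ j, max ‖h.choose_spec.choose j‖ 1 else 1

/-- The constant `c(n, α) = ∏_{j=1}^n (1-p^{-α+n-j})/(1-p^{-α+n+j-1})`. -/
noncomputable def cConst (p n : ℕ) (α : ℝ) : ℝ :=
  ∏ j ∈ Finset.range n,
    (1 - (p : ℝ) ^ (-α + n - (j + 1 : ℕ))) / (1 - (p : ℝ) ^ (-α + n + (j + 1 : ℕ) - 1))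

/-- The Hua measure `μ_s^n` with density `c(n, s+2n)^{-1} γ(z)^{-s-2n}`
against the additive Haar measure `vol`. -/
noncomputable def huaMeasure (p : ℕ) [Fact p.Prime] (n : ℕ) (s : ℝ)
    (vol : Measure (Matrix (Fin n) (Fin n) ℚ_[p])) :
    Measure (Matrix (Fin n) (Fin n) ℚ_[p]) :=
  vol.withDensity fun z =>
    ENNReal.ofReal ((cConst p n (s + 2 * n))⁻¹ * gammaFn z ^ (-(s + 2 * n)))

/-! ### Part 1: integral invertible matrices and Smith normal form -/

theorem norm_mul_entry_le_one {l m n : Type*} [Fintype m]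
    {A : Matrix l m ℚ_[p]} {B : Matrix m n ℚ_[p]}
    (hA : ∀ i j, ‖A i j‖ ≤ 1) (hB : ∀ i j, ‖B i j‖ ≤ 1) (i : l) (j : n) :
    ‖(A * B) i j‖ ≤ 1 := by
  rw [Matrix.mul_apply]
  refine IsUltrametricDist.norm_sum_le_of_forall_le_of_nonneg zero_le_one fun k _ => ?_
  rw [norm_mul]
  exact mul_le_one₀ (hA i k) (norm_nonneg _) (hB k j)

theorem norm_one_entry_le_one {m : Type*} [DecidableEq m] (i j : m) :
    ‖(1 : Matrix m m ℚ_[p]) i j‖ ≤ 1 := by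
  rw [Matrix.one_apply]; split_ifs <;> simp

theorem IsGLZp.mul {m : Type*} [Fintype m] [DecidableEq m] {A B : Matrix m m ℚ_[p]}
    (hA : IsGLZp A) (hB : IsGLZp B) : IsGLZp (A * B) := by
  obtain ⟨hA, A', hA', h1, h2⟩ := hA
  obtain ⟨hB, B', hB', h3, h4⟩ := hB
  refine ⟨norm_mul_entry_le_one hA hB, B' * A', norm_mul_entry_le_one hB' hA', ?_, ?_⟩
  · rw [Matrix.mul_assoc, ← Matrix.mul_assoc B, h3, Matrix.one_mul, h1]
  · rw [Matrix.mul_assoc, ← Matrix.mul_assoc A', h2, Matrix.one_mul, h4]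

theorem IsGLZp.one {m : Type*} [Fintype m] [DecidableEq m] :
    IsGLZp (1 : Matrix m m ℚ_[p]) :=
  ⟨norm_one_entry_le_one, 1, norm_one_entry_le_one, by simp, by simp⟩

theorem IsGLZp.transpose {m : Type*} [Fintype m] [DecidableEq m] {A : Matrix m m ℚ_[p]}
    (hA : IsGLZp A) : IsGLZp Aᵀ := by
  obtain ⟨hA, A', hA', h1, h2⟩ := hA
  refine ⟨fun i j => hA j i, A'ᵀ, fun i j => hA' j i, ?_, ?_⟩
  · rw [← Matrix.transpose_mul, h2, Matrix.transpose_one]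
  · rw [← Matrix.transpose_mul, h1, Matrix.transpose_one]

theorem IsGLZp.submatrix {m k : Type*} [Fintype m] [DecidableEq m] [Fintype k] [DecidableEq k]
    {A : Matrix m m ℚ_[p]} (hA : IsGLZp A) (e f : k ≃ m) : IsGLZp (A.submatrix e f) := by
  obtain ⟨hA, A', hA', h1, h2⟩ := hA
  refine ⟨fun i j => hA _ _, A'.submatrix f e, fun i j => hA' _ _, ?_, ?_⟩
  · rw [Matrix.submatrix_mul_equiv, h1, Matrix.submatrix_one_equiv]
  · rw [Matrix.submatrix_mul_equiv, h2, Matrix.submatrix_one_equiv]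

theorem IsGLZp.lower {m k : Type*} [Fintype m] [DecidableEq m] [Fintype k] [DecidableEq k]
    {C : Matrix k m ℚ_[p]} (hC : ∀ i j, ‖C i j‖ ≤ 1) :
    IsGLZp (Matrix.fromBlocks (1 : Matrix m m ℚ_[p]) 0 C (1 : Matrix k k ℚ_[p])) := by
  refine ⟨?_, Matrix.fromBlocks (1 : Matrix m m ℚ_[p]) 0 (-C) (1 : Matrix k k ℚ_[p]), ?_, ?_, ?_⟩
  · rintro (i | i) (j | j) <;> simp [norm_one_entry_le_one, hC]
  · rintro (i | i) (j | j) <;> simp [norm_one_entry_le_one, hC]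
  · simp [Matrix.fromBlocks_multiply]
  · simp [Matrix.fromBlocks_multiply]

theorem IsGLZp.upper {m k : Type*} [Fintype m] [DecidableEq m] [Fintype k] [DecidableEq k]
    {C : Matrix m k ℚ_[p]} (hC : ∀ i j, ‖C i j‖ ≤ 1) :
    IsGLZp (Matrix.fromBlocks (1 : Matrix m m ℚ_[p]) C 0 (1 : Matrix k k ℚ_[p])) := by
  refine ⟨?_, Matrix.fromBlocks (1 : Matrix m m ℚ_[p]) (-C) 0 (1 : Matrix k k ℚ_[p]), ?_, ?_, ?_⟩
  · rintro (i | i) (j | j) <;> simp [norm_one_entry_le_one, hC]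
  · rintro (i | i) (j | j) <;> simp [norm_one_entry_le_one, hC]
  · simp [Matrix.fromBlocks_multiply]
  · simp [Matrix.fromBlocks_multiply]

theorem IsGLZp.blockDiag {m k : Type*} [Fintype m] [DecidableEq m] [Fintype k] [DecidableEq k]
    {A : Matrix m m ℚ_[p]} {B : Matrix k k ℚ_[p]} (hA : IsGLZp A) (hB : IsGLZp B) :
    IsGLZp (Matrix.fromBlocks A 0 0 B) := by
  obtain ⟨hA, A', hA', h1, h2⟩ := hA
  obtain ⟨hB, B', hB', h3, h4⟩ := hB
  refine ⟨?_, Matrix.fromBlocks A' 0 0 B', ?_, ?_, ?_⟩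
  · rintro (i | i) (j | j) <;> simp [hA, hB]
  · rintro (i | i) (j | j) <;> simp [hA', hB']
  · simp [Matrix.fromBlocks_multiply, h1, h3]
  · simp [Matrix.fromBlocks_multiply, h2, h4]

theorem IsGLZp.scalar {u : ℚ_[p]} (hu : ‖u‖ = 1) :
    IsGLZp (Matrix.diagonal fun _ : Unit => u) := by
  have hu0 : u ≠ 0 := by rintro rfl; simp at hu
  refine ⟨?_, Matrix.diagonal fun _ : Unit => u⁻¹, ?_, ?_, ?_⟩
  · rintro ⟨⟩ ⟨⟩; simp [hu]
  · rintro ⟨⟩ ⟨⟩; simp [hu]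
  · simp [Matrix.diagonal_mul_diagonal, hu0]
  · simp [Matrix.diagonal_mul_diagonal, hu0]

/-- Every square matrix over `ℚ_p` has a Smith normal form. -/
theorem exists_isSmith : ∀ (n : ℕ) (z : Matrix (Fin n) (Fin n) ℚ_[p]), ∃ A d B, IsSmith z A d B
  | 0, z => ⟨1, fun _ => 0, 1, IsGLZp.one, IsGLZp.one, fun j => j.elim0, by ext i; exact i.elim0⟩
  | n + 1, z => by
    by_cases hz : z = 0
    · refine ⟨1, fun _ => 0, 1, IsGLZp.one, IsGLZp.one, fun j => Or.inl rfl, ?_⟩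
      rw [hz]; ext i j; simp
    obtain ⟨⟨i, j⟩, hij⟩ := Finite.exists_max (fun q : Fin (n + 1) × Fin (n + 1) => ‖z q.1 q.2‖)
    have hmax : ∀ a b, ‖z a b‖ ≤ ‖z i j‖ := fun a b => hij (a, b)
    have h0 : z i j ≠ 0 := by
      intro h0
      apply hz
      ext a b
      have := hmax a b
      rw [h0, norm_zero] at this
      simpa using norm_le_zero_iff.mp this
    -- equivalences putting the pivot first
    have key : ∀ i : Fin (n + 1), ∃ e : Unit ⊕ Fin n ≃ Fin (n + 1), e (Sum.inl ()) = i := by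
      intro i
      refine ⟨((Equiv.optionEquivSumPUnit (Fin n)).trans (Equiv.sumComm _ _)).symm.trans
        (finSuccEquiv' i).symm, ?_⟩
      simp
    obtain ⟨e, he⟩ := key i
    obtain ⟨f, hf⟩ := key j
    set z' : Matrix (Unit ⊕ Fin n) (Unit ⊕ Fin n) ℚ_[p] := z.submatrix e f with hz'
    set a : Matrix Unit Unit ℚ_[p] := Matrix.diagonal fun _ => z i j with ha
    have ha11 : z'.toBlocks₁₁ = a := by
      ext ⟨⟩ ⟨⟩; simp [hz', ha, Matrix.toBlocks₁₁, he, hf]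
    set a' : Matrix Unit Unit ℚ_[p] := Matrix.diagonal fun _ => (z i j)⁻¹ with ha'
    let _ : Invertible a := ⟨a', by simp [ha, ha', Matrix.diagonal_mul_diagonal, h0],
      by simp [ha, ha', Matrix.diagonal_mul_diagonal, h0]⟩
    have hinv : ⅟a = a' := rfl
    set b := z'.toBlocks₁₂ with hb
    set c := z'.toBlocks₂₁ with hc
    set D := z'.toBlocks₂₂ with hD
    have hblocks : z' = Matrix.fromBlocks a b c D := by
      rw [← ha11, hb, hc, hD, Matrix.fromBlocks_toBlocks]
    rw [Matrix.fromBlocks_eq_of_invertible₁₁] at hblocks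
    have hpos : 0 < ‖z i j‖ := norm_pos_iff.mpr h0
    have hL : ∀ x y, ‖(c * ⅟a) x y‖ ≤ 1 := by
      intro x y
      rw [hinv, ha', Matrix.mul_diagonal, norm_mul, norm_inv, ← div_eq_mul_inv, div_le_one hpos]
      exact hmax _ _
    have hU : ∀ x y, ‖(⅟a * b) x y‖ ≤ 1 := by
      intro x y
      rw [hinv, ha', Matrix.diagonal_mul, norm_mul, norm_inv, mul_comm, ← div_eq_mul_inv,
        div_le_one hpos]
      exact hmax _ _
    obtain ⟨A, d, B, hA, hB, hd, hS⟩ := exists_isSmith n (D - c * ⅟a * b)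
    obtain ⟨k, hk⟩ : ∃ k : ℤ, ‖z i j‖ = (p : ℝ) ^ (-k) := ⟨_, Padic.norm_eq_zpow_neg_valuation h0⟩
    have hp0 : (p : ℚ_[p]) ≠ 0 := by
      exact_mod_cast (Fact.out : p.Prime).ne_zero
    have hpk : ‖(p : ℚ_[p]) ^ k‖ = ‖z i j‖ := by rw [hk, Padic.norm_p_zpow]
    set u := z i j * ((p : ℚ_[p]) ^ k)⁻¹ with hu
    have hu1 : ‖u‖ = 1 := by
      rw [hu, norm_mul, norm_inv, hpk, mul_inv_cancel₀ hpos.ne']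
    have hau : a = (Matrix.diagonal fun _ : Unit => u) *
        (Matrix.diagonal fun _ : Unit => (p : ℚ_[p]) ^ k) := by
      rw [Matrix.diagonal_mul_diagonal, ha, hu]
      congr 1; ext
      rw [mul_assoc, inv_mul_cancel₀ (zpow_ne_zero _ hp0), mul_one]
    set d' : Unit ⊕ Fin n → ℚ_[p] := Sum.elim (fun _ => (p : ℚ_[p]) ^ k) d with hd'
    have hmid : Matrix.fromBlocks a 0 0 (D - c * ⅟a * b) =
        Matrix.fromBlocks (Matrix.diagonal fun _ : Unit => u) 0 0 A * Matrix.diagonal d' *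
          Matrix.fromBlocks (1 : Matrix Unit Unit ℚ_[p]) 0 0 B := by
      rw [hS, hd', ← Matrix.fromBlocks_diagonal, Matrix.fromBlocks_multiply,
        Matrix.fromBlocks_multiply]
      simp [hau]
    set AA := Matrix.fromBlocks 1 0 (c * ⅟a) 1 *
      Matrix.fromBlocks (Matrix.diagonal fun _ : Unit => u) 0 0 A with hAA
    set BB := Matrix.fromBlocks (1 : Matrix Unit Unit ℚ_[p]) 0 0 B *
      Matrix.fromBlocks 1 (⅟a * b) 0 1 with hBB
    have hAAg : IsGLZp AA := (IsGLZp.lower hL).mul ((IsGLZp.scalar hu1).blockDiag hA)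
    have hBBg : IsGLZp BB := (IsGLZp.one.blockDiag hB).mul (IsGLZp.upper hU)
    have hfin : z' = AA * Matrix.diagonal d' * BB := by
      rw [hblocks, hmid, hAA, hBB]; simp only [Matrix.mul_assoc]
    refine ⟨AA.submatrix e.symm e.symm, d' ∘ e.symm, BB.submatrix e.symm f.symm,
      hAAg.submatrix _ _, hBBg.submatrix _ _, ?_, ?_⟩
    · intro x
      simp only [Function.comp_apply]
      rcases e.symm x with y | y
      · right; exact ⟨-k, by simp [hd']⟩
      · simpa [hd'] using hd y
    · rw [← Matrix.submatrix_diagonal_equiv, Matrix.submatrix_mul_equiv,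
        Matrix.submatrix_mul_equiv, ← hfin, hz']
      simp

/-! ### Part 2: Haar measures on `ℚ_p` and `ℚ_p^n` -/

theorem haar_eq_smul_of_one {G : Type*} [AddCommGroup G] [TopologicalSpace G]
    [IsTopologicalAddGroup G] [MeasurableSpace G] [BorelSpace G] [LocallyCompactSpace G]
    [SecondCountableTopology G] (μ ν : Measure G) [μ.IsAddHaarMeasure] [ν.IsAddHaarMeasure]
    (K : Set G) (hK : ν K = 1) : μ = μ K • ν := by
  have h := Measure.isAddLeftInvariant_eq_smul μ ν
  have hKμ : μ K = (Measure.addHaarScalarFactor μ ν : ℝ≥0∞) := by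
    conv_lhs => rw [h]
    rw [Measure.smul_apply, hK, ENNReal.smul_def, smul_eq_mul, mul_one]
  rw [hKμ]
  exact h

/-- The Haar measure on `ℚ_p` giving mass one to `ℤ_p`. -/
noncomputable def lineVol (p : ℕ) [Fact p.Prime] : Measure ℚ_[p] :=
  Measure.addHaarMeasure
    ⟨⟨Metric.closedBall 0 1, isCompact_closedBall 0 1⟩,
      ⟨0, Metric.ball_subset_interior_closedBall (Metric.mem_ball_self one_pos)⟩⟩

instance : (lineVol p).IsAddHaarMeasure := by
  unfold lineVol; infer_instance

theorem lineVol_one : lineVol p (Metric.closedBall 0 1) = 1 :=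
  Measure.addHaarMeasure_self

theorem prime_cast_ne_zero : (p : ℚ_[p]) ≠ 0 := by
  exact_mod_cast (Fact.out : p.Prime).ne_zero

theorem one_lt_prime_real : (1 : ℝ) < p := by
  exact_mod_cast (Fact.out : p.Prime).one_lt

theorem closedBall_succ (k : ℤ) :
    Metric.closedBall (0 : ℚ_[p]) ((p : ℝ) ^ (k + 1)) =
      ⋃ i ∈ Finset.range p, (fun x => -((i : ℚ_[p]) * (p : ℚ_[p]) ^ (-(k + 1))) + x) ⁻¹'
        Metric.closedBall (0 : ℚ_[p]) ((p : ℝ) ^ k) := by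
  have hp := one_lt_prime_real (p := p)
  have hp0 : (0 : ℝ) < p := by linarith
  ext x
  simp only [Set.mem_iUnion, Set.mem_preimage, mem_closedBall_zero_iff, Finset.mem_range,
    exists_prop]
  have hkk : (p : ℝ) ^ k ≤ (p : ℝ) ^ (k + 1) := zpow_le_zpow_right₀ hp.le (by lia)
  constructor
  · intro hx
    have hy : ‖x * (p : ℚ_[p]) ^ (k + 1)‖ ≤ 1 := by
      rw [norm_mul, Padic.norm_p_zpow, _root_.zpow_neg, ← div_eq_mul_inv, div_le_one (by positivity)]
      exact hx
    obtain ⟨y, hyx⟩ : ∃ y : ℤ_[p], (y : ℚ_[p]) = x * (p : ℚ_[p]) ^ (k + 1) := ⟨⟨_, hy⟩, rfl⟩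
    obtain ⟨i, hi, hi'⟩ := PadicInt.exists_mem_range y
    refine ⟨i, hi, ?_⟩
    rw [PadicInt.maximalIdeal_eq_span_p, Ideal.mem_span_singleton] at hi'
    have h1 := (PadicInt.norm_le_pow_iff_mem_span_pow _ 1).mpr
      (by simpa [Ideal.mem_span_singleton] using hi')
    have h2 : ‖x * (p : ℚ_[p]) ^ (k + 1) - i‖ ≤ (p : ℝ)⁻¹ := by
      rw [PadicInt.norm_def] at h1
      simpa [hyx] using h1
    have h3 : -((i : ℚ_[p]) * (p : ℚ_[p]) ^ (-(k + 1))) + x =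
        (x * (p : ℚ_[p]) ^ (k + 1) - i) * (p : ℚ_[p]) ^ (-(k + 1)) := by
      rw [sub_mul, mul_assoc, ← zpow_add₀ prime_cast_ne_zero]
      simp; ring
    rw [h3, norm_mul, Padic.norm_p_zpow, neg_neg, zpow_add₀ hp0.ne', zpow_one]
    calc _ ≤ (p : ℝ)⁻¹ * ((p : ℝ) ^ k * p) := by gcongr
      _ = _ := by field_simp
  · rintro ⟨i, hi, hx⟩
    have h4 : x = (-((i : ℚ_[p]) * (p : ℚ_[p]) ^ (-(k + 1))) + x) +
      (i : ℚ_[p]) * (p : ℚ_[p]) ^ (-(k + 1)) := by ring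
    rw [h4]
    refine (IsUltrametricDist.norm_add_le_max _ _).trans (max_le (hx.trans hkk) ?_)
    rw [norm_mul, Padic.norm_p_zpow, neg_neg]
    have : ‖(i : ℚ_[p])‖ ≤ 1 := by exact_mod_cast Padic.norm_int_le_one (p := p) (i : ℤ)
    calc _ ≤ 1 * (p : ℝ) ^ (k + 1) := by gcongr
      _ = _ := one_mul _

theorem lineVol_succ (k : ℤ) :
    lineVol p (Metric.closedBall 0 ((p : ℝ) ^ (k + 1))) =
      p * lineVol p (Metric.closedBall 0 ((p : ℝ) ^ k)) := by
  have hp := one_lt_prime_real (p := p)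
  have hp0 : (0 : ℝ) < p := by linarith
  rw [closedBall_succ, measure_biUnion_finset]
  · simp only [measure_preimage_add]
    simp
  · intro i hi j hj hij
    rw [Function.onFun, Set.disjoint_left]
    intro x hx hy
    simp only [Set.mem_preimage, mem_closedBall_zero_iff] at hx hy
    have h1 : ((i : ℚ_[p]) - j) * (p : ℚ_[p]) ^ (-(k + 1)) =
      (-((j : ℚ_[p]) * (p : ℚ_[p]) ^ (-(k + 1))) + x) -
        (-((i : ℚ_[p]) * (p : ℚ_[p]) ^ (-(k + 1))) + x) := by ring
    have h2 : ‖((i : ℚ_[p]) - j) * (p : ℚ_[p]) ^ (-(k + 1))‖ ≤ (p : ℝ) ^ k := by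
      rw [h1, sub_eq_add_neg]
      refine (IsUltrametricDist.norm_add_le_max _ _).trans (max_le hy ?_)
      rw [norm_neg]
      exact hx
    have h3 : ‖((i : ℚ_[p]) - j)‖ = 1 := by
      have : ((i : ℚ_[p]) - j) = (((i : ℤ) - (j : ℤ) : ℤ) : ℚ_[p]) := by push_cast; rfl
      rw [this]
      refine le_antisymm (Padic.norm_int_le_one _) (not_lt.mp fun h => ?_)
      rw [Padic.norm_intCast_lt_one_iff] at h
      simp only [Finset.coe_range, Set.mem_Iio] at hi hj
      apply hij
      have := Int.eq_zero_of_abs_lt_dvd h (by rw [abs_lt]; constructor <;> lia)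
      lia
    rw [norm_mul, h3, one_mul, Padic.norm_p_zpow, neg_neg, zpow_le_zpow_iff_right₀ hp] at h2
    lia
  · intro i hi
    exact (Metric.isClosed_closedBall.measurableSet).preimage (by fun_prop)

theorem lineVol_zpow (k : ℤ) :
    lineVol p (Metric.closedBall 0 ((p : ℝ) ^ k)) = ENNReal.ofReal ((p : ℝ) ^ k) := by
  have hp := one_lt_prime_real (p := p)
  have hp0 : (0 : ℝ) < p := by linarith
  have hstep : ∀ k : ℤ, ENNReal.ofReal ((p : ℝ) ^ (k + 1)) = p * ENNReal.ofReal ((p : ℝ) ^ k) := by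
    intro k
    rw [zpow_add₀ hp0.ne', zpow_one, mul_comm, ENNReal.ofReal_mul hp0.le, ENNReal.ofReal_natCast]
  induction k using Int.induction_on with
  | zero => simpa using lineVol_one
  | succ i ih => rw [lineVol_succ, hstep, ih]
  | pred i ih =>
    have h1 := lineVol_succ (p := p) (-(i : ℤ) - 1)
    have h2 := hstep (-(i : ℤ) - 1)
    rw [sub_add_cancel] at h1 h2
    rw [ih, h2] at h1
    exact ((ENNReal.mul_right_inj (by exact_mod_cast (Fact.out : p.Prime).ne_zero)
      (ENNReal.natCast_ne_top p)).mp h1).symm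

theorem lineVol_norm {c : ℚ_[p]} (hc : c ≠ 0) :
    lineVol p {x | ‖c * x‖ ≤ 1} = ENNReal.ofReal ‖c‖⁻¹ := by
  have h : {x : ℚ_[p] | ‖c * x‖ ≤ 1} = Metric.closedBall 0 ((p : ℝ) ^ c.valuation) := by
    ext x
    rw [Set.mem_ofPred_eq, norm_mul, mem_closedBall_zero_iff, mul_comm, ← le_div_iff₀
      (norm_pos_iff.mpr hc), one_div, Padic.norm_eq_zpow_neg_valuation hc, ← _root_.zpow_neg, neg_neg]
  rw [h, lineVol_zpow, Padic.norm_eq_zpow_neg_valuation hc, ← _root_.zpow_neg, neg_neg]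

/-- The normalized Haar measure on `ℚ_p^n`. -/
noncomputable def vecVol (p : ℕ) [Fact p.Prime] (n : ℕ) : Measure (Fin n → ℚ_[p]) :=
  Measure.pi fun _ => lineVol p

instance (n : ℕ) : (vecVol p n).IsAddHaarMeasure := by
  unfold vecVol; infer_instance

instance (n : ℕ) : SigmaFinite (vecVol p n) := by
  unfold vecVol; infer_instance

theorem vecVol_box {n : ℕ} {e : Fin n → ℚ_[p]} (he : ∀ j, e j ≠ 0) :
    vecVol p n {x | ∀ j, ‖e j * x j‖ ≤ 1} = ∏ j, ENNReal.ofReal ‖e j‖⁻¹ := by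
  have : {x : Fin n → ℚ_[p] | ∀ j, ‖e j * x j‖ ≤ 1} =
      Set.univ.pi fun j => {x | ‖e j * x‖ ≤ 1} := by
    ext x; simp
  rw [this, vecVol, Measure.pi_pi]
  exact Finset.prod_congr rfl fun j _ => lineVol_norm (he j)

theorem vecVol_cube (n : ℕ) : vecVol p n {x | ∀ j, ‖x j‖ ≤ 1} = 1 := by
  have := vecVol_box (p := p) (n := n) (e := fun _ => 1) (fun _ => one_ne_zero)
  simpa using this

theorem map_linear {n : ℕ} {M M' : Matrix (Fin n) (Fin n) ℚ_[p]} (h1 : M * M' = 1)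
    (h2 : M' * M = 1) :
    (vecVol p n).map (fun x => M *ᵥ x) =
      vecVol p n {x | ∀ j, ‖(M *ᵥ x) j‖ ≤ 1} • vecVol p n := by
  let E : (Fin n → ℚ_[p]) ≃+ (Fin n → ℚ_[p]) :=
    { toFun := fun x => M *ᵥ x
      invFun := fun x => M' *ᵥ x
      left_inv := fun x => by simp [h2]
      right_inv := fun x => by simp [h1]
      map_add' := fun x y => Matrix.mulVec_add _ _ _ }
  have hc : Continuous fun x : Fin n → ℚ_[p] => M *ᵥ x := by fun_prop
  have hc' : Continuous fun x : Fin n → ℚ_[p] => M' *ᵥ x := by fun_prop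
  have : (Measure.map (fun x => M *ᵥ x) (vecVol p n)).IsAddHaarMeasure :=
    E.isAddHaarMeasure_map (vecVol p n) hc hc'
  have := haar_eq_smul_of_one ((vecVol p n).map (fun x => M *ᵥ x)) (vecVol p n) _ (vecVol_cube n)
  rw [Measure.map_apply hc.measurable] at this
  · exact this
  · have : {x : Fin n → ℚ_[p] | ∀ j, ‖x j‖ ≤ 1} = ⋂ j, {x | ‖x j‖ ≤ 1} := by ext; simp
    rw [this]
    exact MeasurableSet.iInter fun j => (isClosed_le (by fun_prop) (by fun_prop)).measurableSet

theorem norm_mulVec_le_one {m n : Type*} [Fintype n] {A : Matrix m n ℚ_[p]} {x : n → ℚ_[p]}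
    (hA : ∀ i j, ‖A i j‖ ≤ 1) (hx : ∀ j, ‖x j‖ ≤ 1) (i : m) : ‖(A *ᵥ x) i‖ ≤ 1 := by
  rw [Matrix.mulVec, dotProduct]
  refine IsUltrametricDist.norm_sum_le_of_forall_le_of_nonneg zero_le_one fun k _ => ?_
  rw [norm_mul]
  exact mul_le_one₀ (hA i k) (norm_nonneg _) (hx k)

theorem IsGLZp.mulVec_mem {n : ℕ} {B : Matrix (Fin n) (Fin n) ℚ_[p]} (hB : IsGLZp B)
    (x : Fin n → ℚ_[p]) : (∀ j, ‖(B *ᵥ x) j‖ ≤ 1) ↔ ∀ j, ‖x j‖ ≤ 1 := by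
  obtain ⟨hB, B', hB', h1, h2⟩ := hB
  refine ⟨fun h => ?_, fun h => norm_mulVec_le_one hB h⟩
  have := norm_mulVec_le_one hB' h
  simpa [h2] using this

theorem IsGLZp.measurePreserving {n : ℕ} {B : Matrix (Fin n) (Fin n) ℚ_[p]} (hB : IsGLZp B) :
    MeasurePreserving (fun x => B *ᵥ x) (vecVol p n) (vecVol p n) := by
  have h := hB.mulVec_mem
  obtain ⟨hB, B', hB', h1, h2⟩ := hB
  refine ⟨Continuous.measurable (by fun_prop), ?_⟩
  rw [map_linear h1 h2]
  simp only [h, vecVol_cube, one_smul]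

theorem measurableSet_vecBox {n m : ℕ} {f : (Fin n → ℚ_[p]) → Fin m → ℚ_[p]} (hf : Continuous f) :
    MeasurableSet {x | ∀ j, ‖f x j‖ ≤ 1} := by
  have : {x | ∀ j, ‖f x j‖ ≤ 1} = ⋂ j, {x | ‖f x j‖ ≤ 1} := by ext; simp
  rw [this]
  exact MeasurableSet.iInter fun j => (isClosed_le (by fun_prop) (by fun_prop)).measurableSet

/-- Change of variables for `x ↦ diag(e) B x`. -/
theorem map_diag_GL {n : ℕ} {B : Matrix (Fin n) (Fin n) ℚ_[p]} (hB : IsGLZp B)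
    {e : Fin n → ℚ_[p]} (he : ∀ j, e j ≠ 0) :
    (vecVol p n).map (fun x => (Matrix.diagonal e * B) *ᵥ x) =
      (∏ j, ENNReal.ofReal ‖e j‖⁻¹) • vecVol p n := by
  have hp := hB.measurePreserving
  obtain ⟨hB, B', hB', h1, h2⟩ := hB
  have hd1 : Matrix.diagonal e * Matrix.diagonal (fun j => (e j)⁻¹) = 1 := by
    rw [Matrix.diagonal_mul_diagonal, ← Matrix.diagonal_one]; congr 1; ext j; simp [he j]
  have hd2 : Matrix.diagonal (fun j => (e j)⁻¹) * Matrix.diagonal e = 1 := by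
    rw [Matrix.diagonal_mul_diagonal, ← Matrix.diagonal_one]; congr 1; ext j; simp [he j]
  rw [map_linear (M' := B' * Matrix.diagonal fun j => (e j)⁻¹)]
  · congr 1
    have hb : MeasurableSet {x : Fin n → ℚ_[p] | ∀ j, ‖e j * x j‖ ≤ 1} :=
      measurableSet_vecBox (f := fun x j => e j * x j) (by fun_prop)
    rw [← vecVol_box he, ← hp.measure_preimage hb.nullMeasurableSet]
    congr 1
    ext x
    simp [← Matrix.mulVec_mulVec, Matrix.mulVec_diagonal]
  · rw [Matrix.mul_assoc, ← Matrix.mul_assoc B, h1, Matrix.one_mul, hd1]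
  · rw [Matrix.mul_assoc, ← Matrix.mul_assoc _ _ B, hd2, Matrix.one_mul, h2]

/-! ### Part 3: the one-row integral -/

theorem norm_dot_le {n : ℕ} {r : ℝ} (hr : 0 ≤ r) {u y : Fin n → ℚ_[p]} (hu : ∀ j, ‖u j‖ ≤ r)
    (hy : ∀ j, ‖y j‖ ≤ 1) : ‖u ⬝ᵥ y‖ ≤ r := by
  rw [dotProduct]
  refine IsUltrametricDist.norm_sum_le_of_forall_le_of_nonneg hr fun k _ => ?_
  rw [norm_mul]
  calc _ ≤ r * 1 := mul_le_mul (hu k) (hy k) (norm_nonneg _) hr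
    _ = r := mul_one r

theorem shear_isGLZp {n : ℕ} (i : Fin n) {r : Fin n → ℚ_[p]} (hi : r i = 0)
    (hr : ∀ j, ‖r j‖ ≤ 1) : IsGLZp (1 + Matrix.vecMulVec (Pi.single i 1) r) := by
  have hs : ∀ a b, ‖Matrix.vecMulVec (Pi.single i 1) r a b‖ ≤ 1 := by
    intro a b
    rw [Matrix.vecMulVec_apply]
    by_cases h : a = i
    · subst h; simpa using hr b
    · simp [h]
  have hsq : Matrix.vecMulVec (Pi.single i 1) r * Matrix.vecMulVec (Pi.single i 1) r = 0 := by
    rw [Matrix.vecMulVec_mul_vecMulVec]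
    simp [hi]
  refine ⟨?_, 1 + -Matrix.vecMulVec (Pi.single i 1) r, ?_, ?_, ?_⟩
  · intro a b
    exact (IsUltrametricDist.norm_add_le_max _ _).trans (max_le (norm_one_entry_le_one a b) (hs a b))
  · intro a b
    refine (IsUltrametricDist.norm_add_le_max _ _).trans (max_le (norm_one_entry_le_one a b) ?_)
    rw [Matrix.neg_apply, norm_neg]
    exact hs a b
  · rw [mul_add, add_mul, mul_neg, add_mul, hsq]; simp
  · rw [mul_add, add_mul, add_mul, neg_mul, neg_mul, hsq]; simp

theorem vecVol_halfspace {n : ℕ} (u : Fin n → ℚ_[p]) :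
    vecVol p n {y | (∀ j, ‖y j‖ ≤ 1) ∧ ‖u ⬝ᵥ y‖ ≤ 1} = ENNReal.ofReal (max 1 ‖u‖)⁻¹ := by
  by_cases hu : ‖u‖ ≤ 1
  · rw [max_eq_left hu, inv_one, ENNReal.ofReal_one, ← vecVol_cube (p := p) n]
    congr 1
    ext y
    exact ⟨fun h => h.1, fun h => ⟨h, norm_dot_le zero_le_one (fun j => (norm_le_pi_norm u j).trans hu) h⟩⟩
  push Not at hu
  have : Nonempty (Fin n) := by
    by_contra h
    rw [not_nonempty_iff] at h
    have : u = 0 := Subsingleton.elim _ _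
    rw [this, norm_zero] at hu
    linarith
  obtain ⟨i, hi⟩ : ∃ i, ‖u i‖ = ‖u‖ := by
    obtain ⟨i, hi⟩ := Finite.exists_max (fun i => ‖u i‖)
    exact ⟨i, le_antisymm (norm_le_pi_norm u i) ((pi_norm_le_iff_of_nonneg (norm_nonneg _)).mpr hi)⟩
  have hmax : ∀ j, ‖u j‖ ≤ ‖u i‖ := fun j => by rw [hi]; exact norm_le_pi_norm u j
  have hpos : 0 < ‖u i‖ := by rw [hi]; linarith
  have hne : u i ≠ 0 := norm_pos_iff.mp hpos
  set r : Fin n → ℚ_[p] := Function.update (fun j => u j / u i) i 0 with hr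
  have hB := shear_isGLZp (p := p) i (r := r) (by simp [hr]) (by
    intro j
    by_cases h : j = i
    · subst h; simp [hr]
    · simp only [hr, Function.update_of_ne h, norm_div]
      exact (div_le_one hpos).mpr (hmax j))
  set B : Matrix (Fin n) (Fin n) ℚ_[p] := 1 + Matrix.vecMulVec (Pi.single i 1) r
  have hBi : ∀ y : Fin n → ℚ_[p], u i * (B *ᵥ y) i = u ⬝ᵥ y := by
    intro y
    have h1 : u i • r + Pi.single i (u i) = u := by
      ext j
      by_cases h : j = i
      · subst h; simp [hr]
      · simp [hr, h]; field_simp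
    simp only [B, Matrix.add_mulVec, Matrix.one_mulVec, Matrix.vecMulVec_mulVec, Pi.add_apply]
    conv_rhs => rw [← h1]
    simp [add_dotProduct]
    ring
  set e : Fin n → ℚ_[p] := Function.update (fun _ => 1) i (u i) with he
  have he0 : ∀ j, e j ≠ 0 := by
    intro j
    by_cases h : j = i
    · subst h; simpa [he] using hne
    · simp [he, h]
  have hset : {y : Fin n → ℚ_[p] | (∀ j, ‖y j‖ ≤ 1) ∧ ‖u ⬝ᵥ y‖ ≤ 1} =
      (fun y => B *ᵥ y) ⁻¹' {y | ∀ j, ‖e j * y j‖ ≤ 1} := by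
    ext y
    simp only [Set.mem_preimage, Set.mem_ofPred_eq]
    rw [← hB.mulVec_mem, ← hBi]
    constructor
    · rintro ⟨h1, h2⟩ j
      by_cases h : j = i
      · subst h; simpa [he] using h2
      · simpa [he, h] using h1 j
    · intro h
      have h2 := h i
      simp only [he, Function.update_self] at h2
      refine ⟨fun j => ?_, h2⟩
      by_cases hj : j = i
      · subst hj
        rw [norm_mul] at h2
        refine le_trans ?_ h2
        exact le_mul_of_one_le_left (norm_nonneg _) (by rw [hi]; exact hu.le)
      · simpa [he, hj] using h j
  have hb : MeasurableSet {x : Fin n → ℚ_[p] | ∀ j, ‖e j * x j‖ ≤ 1} :=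
    measurableSet_vecBox (f := fun x j => e j * x j) (by fun_prop)
  rw [hset, hB.measurePreserving.measure_preimage hb.nullMeasurableSet, vecVol_box he0,
    Finset.prod_eq_single i]
  · simp only [he, Function.update_self, hi, max_eq_right hu.le]
  · intro j _ hj
    simp [he, hj]
  · simp

/-- The constant appearing in the integration over one row of length `n`. -/
noncomputable def rowConst (p n : ℕ) (β : ℝ) : ℝ≥0∞ :=
  (1 - (p : ℝ≥0∞) ^ (-β)) * (1 - (p : ℝ≥0∞) ^ ((n : ℝ) - β))⁻¹

theorem exists_max_norm_eq {n : ℕ} (u : Fin n → ℚ_[p]) : ∃ m : ℕ, max 1 ‖u‖ = (p : ℝ) ^ m := by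
  by_cases hu : ‖u‖ ≤ 1
  · exact ⟨0, by simp [hu]⟩
  push Not at hu
  have : Nonempty (Fin n) := by
    by_contra h
    rw [not_nonempty_iff] at h
    have : u = 0 := Subsingleton.elim _ _
    rw [this, norm_zero] at hu
    linarith
  obtain ⟨i, hi⟩ : ∃ i, ‖u i‖ = ‖u‖ := by
    obtain ⟨i, hi⟩ := Finite.exists_max (fun i => ‖u i‖)
    exact ⟨i, le_antisymm (norm_le_pi_norm u i) ((pi_norm_le_iff_of_nonneg (norm_nonneg _)).mpr hi)⟩
  have hne : u i ≠ 0 := norm_pos_iff.mp (by rw [hi]; linarith)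
  have hv := Padic.norm_eq_zpow_neg_valuation hne
  rw [max_eq_right hu.le, ← hi, hv]
  have h1 : (p : ℝ) ^ (0 : ℤ) < (p : ℝ) ^ (-(u i).valuation) := by
    rw [← hv, hi, zpow_zero]; exact hu
  rw [zpow_lt_zpow_iff_right₀ one_lt_prime_real] at h1
  refine ⟨(-(u i).valuation).toNat, ?_⟩
  rw [← zpow_natCast, Int.toNat_of_nonneg h1.le]

theorem vecVol_ball (n k : ℕ) :
    vecVol p n (Metric.closedBall 0 ((p : ℝ) ^ k)) = ((p : ℝ≥0∞) ^ n) ^ k := by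
  have hp : (0 : ℝ) < p := by linarith [one_lt_prime_real (p := p)]
  have h : Metric.closedBall (0 : Fin n → ℚ_[p]) ((p : ℝ) ^ k) =
      {x | ∀ j, ‖(p : ℚ_[p]) ^ k * x j‖ ≤ 1} := by
    ext x
    rw [mem_closedBall_zero_iff, pi_norm_le_iff_of_nonneg (by positivity)]
    refine forall_congr' fun j => ?_
    rw [norm_mul, Padic.norm_p_pow, _root_.zpow_neg, zpow_natCast, mul_comm, ← div_eq_mul_inv,
      div_le_one (by positivity)]
  rw [h, vecVol_box (fun j => pow_ne_zero _ prime_cast_ne_zero)]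
  simp only [Padic.norm_p_pow, _root_.zpow_neg, inv_inv, zpow_natCast, Finset.prod_const,
    Finset.card_univ, Fintype.card_fin]
  rw [ENNReal.ofReal_pow hp.le, ENNReal.ofReal_natCast, pow_right_comm]

theorem tsum_tail (A : ℝ≥0∞) (hA : A < 1) (m : ℕ) :
    ∑' k : ℕ, (1 - A) * A ^ k * (if m ≤ k then 1 else 0) = A ^ m := by
  have h0 : (1 - A) ≠ 0 := (tsub_pos_of_lt hA).ne'
  have h1 : (1 - A) ≠ ⊤ := (tsub_le_self.trans_lt ENNReal.one_lt_top).ne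
  rw [← ENNReal.summable.sum_add_tsum_nat_add' (k := m), Finset.sum_eq_zero, zero_add]
  · simp only [Nat.le_add_left, if_true, mul_one, pow_add]
    simp_rw [← mul_assoc]
    rw [ENNReal.tsum_mul_right, ENNReal.tsum_mul_left, ENNReal.tsum_geometric,
      ENNReal.mul_inv_cancel h0 h1, one_mul]
  · intro k hk
    rw [if_neg (by simpa using hk), mul_zero]

theorem lintegral_max_norm {n : ℕ} {β : ℝ} (hβ : n < β) :
    ∫⁻ u, (ENNReal.ofReal (max 1 ‖u‖)⁻¹) ^ β ∂(vecVol p n) = rowConst p n β := by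
  have hp := one_lt_prime_real (p := p)
  have hp0 : (0 : ℝ) < p := by linarith
  have hpE : (1 : ℝ≥0∞) < p := by exact_mod_cast (Fact.out : p.Prime).one_lt
  have hpE0 : (p : ℝ≥0∞) ≠ 0 := (zero_lt_one.trans hpE).ne'
  have hβ0 : 0 < β := lt_of_le_of_lt (Nat.cast_nonneg n) hβ
  set A : ℝ≥0∞ := (p : ℝ≥0∞) ^ (-β) with hA
  have hA1 : A < 1 := ENNReal.rpow_lt_one_of_one_lt_of_neg hpE (by linarith)
  have hpt : ∀ u : Fin n → ℚ_[p], (ENNReal.ofReal (max 1 ‖u‖)⁻¹) ^ β =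
      ∑' k : ℕ, (1 - A) * A ^ k *
        (Metric.closedBall (0 : Fin n → ℚ_[p]) ((p : ℝ) ^ k)).indicator 1 u := by
    intro u
    obtain ⟨m, hm⟩ := exists_max_norm_eq u
    have h1 : (ENNReal.ofReal (max 1 ‖u‖)⁻¹) ^ β = A ^ m := by
      rw [hm, ENNReal.ofReal_inv_of_pos (by positivity), ENNReal.ofReal_pow hp0.le,
        ENNReal.ofReal_natCast, hA, ENNReal.inv_rpow, ← ENNReal.rpow_natCast, ← ENNReal.rpow_natCast,
        ← ENNReal.rpow_neg, ← ENNReal.rpow_mul, ← ENNReal.rpow_mul]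
      congr 1; ring
    rw [h1, ← tsum_tail A hA1 m]
    refine tsum_congr fun k => ?_
    congr 1
    have h2 : u ∈ Metric.closedBall (0 : Fin n → ℚ_[p]) ((p : ℝ) ^ k) ↔ m ≤ k := by
      rw [mem_closedBall_zero_iff, ← pow_le_pow_iff_right₀ hp (n := m), ← hm, max_le_iff]
      exact ⟨fun h => ⟨one_le_pow₀ hp.le, h⟩, fun h => h.2⟩
    by_cases hmk : m ≤ k
    · rw [if_pos hmk, Set.indicator_of_mem (h2.mpr hmk), Pi.one_apply]
    · rw [if_neg hmk, Set.indicator_of_notMem (fun h => hmk (h2.mp h))]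
  simp_rw [hpt]
  have hmeas : ∀ k : ℕ, MeasurableSet (Metric.closedBall (0 : Fin n → ℚ_[p]) ((p : ℝ) ^ k)) :=
    fun k => Metric.isClosed_closedBall.measurableSet
  rw [lintegral_tsum (fun k => ((measurable_one.indicator (hmeas k)).const_mul _).aemeasurable)]
  have hk : ∀ k : ℕ, ∫⁻ u, (1 - A) * A ^ k *
        (Metric.closedBall (0 : Fin n → ℚ_[p]) ((p : ℝ) ^ k)).indicator 1 u ∂(vecVol p n) =
      (1 - A) * ((p : ℝ≥0∞) ^ ((n : ℝ) - β)) ^ k := by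
    intro k
    rw [lintegral_const_mul _ (measurable_one.indicator (hmeas k)), lintegral_indicator_one (hmeas k),
      vecVol_ball, mul_assoc, ← mul_pow, hA, sub_eq_neg_add,
      ENNReal.rpow_add _ _ hpE0 (ENNReal.natCast_ne_top p), ENNReal.rpow_natCast]
  simp_rw [hk]
  rw [ENNReal.tsum_mul_left, ENNReal.tsum_geometric, rowConst]

/-- A lattice in the unit cube given by elementary divisors. -/
def GoodLattice {n : ℕ} (L : Set (Fin n → ℚ_[p])) : Prop :=
  ∃ (B : Matrix (Fin n) (Fin n) ℚ_[p]) (e : Fin n → ℚ_[p]), IsGLZp B ∧ (∀ j, e j ≠ 0) ∧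
    L = {x | ∀ j, ‖((Matrix.diagonal e * B) *ᵥ x) j‖ ≤ 1}

theorem GoodLattice.lintegral_row {n : ℕ} {L : Set (Fin n → ℚ_[p])} (hL : GoodLattice L)
    {β : ℝ} (hβ : n < β) :
    ∫⁻ w, (vecVol p n (L ∩ {x | ‖w ⬝ᵥ x‖ ≤ 1})) ^ β ∂(vecVol p n) =
      (vecVol p n L) ^ (β - 1) * rowConst p n β := by
  have hβ0 : 0 < β := lt_of_le_of_lt (Nat.cast_nonneg n) hβ
  obtain ⟨B, e, hB, he, rfl⟩ := hL
  have hmap := map_diag_GL hB he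
  set κ : ℝ≥0∞ := ∏ j, ENNReal.ofReal ‖e j‖⁻¹ with hκ
  have hκ0 : κ ≠ 0 := Finset.prod_ne_zero_iff.mpr fun j _ => by
    have := norm_pos_iff.mpr (he j)
    simp [he j]
  have hκt : κ ≠ ⊤ := ENNReal.prod_ne_top fun j _ => ENNReal.ofReal_ne_top
  have hcube : MeasurableSet {x : Fin n → ℚ_[p] | ∀ j, ‖x j‖ ≤ 1} :=
    measurableSet_vecBox (f := fun x => x) (by fun_prop)
  have hTm : Measurable fun x : Fin n → ℚ_[p] => (Matrix.diagonal e * B) *ᵥ x :=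
    Continuous.measurable (by fun_prop)
  have hvol : vecVol p n {x | ∀ j, ‖((Matrix.diagonal e * B) *ᵥ x) j‖ ≤ 1} = κ := by
    have := congrArg (fun μ => μ {x : Fin n → ℚ_[p] | ∀ j, ‖x j‖ ≤ 1}) hmap
    simp only [Measure.smul_apply, vecVol_cube, smul_eq_mul, mul_one] at this
    rw [Measure.map_apply hTm hcube] at this
    exact this
  obtain ⟨hBi, B', hB'i, h1, h2⟩ := id hB
  have hd2 : Matrix.diagonal (fun j => (e j)⁻¹) * Matrix.diagonal e = 1 := by
    rw [Matrix.diagonal_mul_diagonal, ← Matrix.diagonal_one]; congr 1; ext j; simp [he j]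
  have hB' : IsGLZp B'ᵀ := IsGLZp.transpose ⟨hB'i, B, hBi, h2, h1⟩
  have hmap' := map_diag_GL hB' (e := fun j => (e j)⁻¹) (fun j => inv_ne_zero (he j))
  set S := Matrix.diagonal (fun j => (e j)⁻¹) * B'ᵀ with hS
  have hST : Sᵀ * (Matrix.diagonal e * B) = 1 := by
    rw [hS, Matrix.transpose_mul, Matrix.transpose_transpose, Matrix.diagonal_transpose,
      Matrix.mul_assoc, ← Matrix.mul_assoc _ _ B, hd2, Matrix.one_mul, h2]
  have hκ' : ∏ j, ENNReal.ofReal ‖(e j)⁻¹‖⁻¹ = κ⁻¹ := by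
    rw [hκ, ENNReal.prod_inv_distrib]
    · refine Finset.prod_congr rfl fun j _ => ?_
      rw [norm_inv, inv_inv, ENNReal.ofReal_inv_of_pos (norm_pos_iff.mpr (he j)), inv_inv]
    · intro i _ j _ _
      right
      exact ENNReal.ofReal_ne_top
  rw [hκ'] at hmap'
  have hinner : ∀ w : Fin n → ℚ_[p],
      vecVol p n ({x | ∀ j, ‖((Matrix.diagonal e * B) *ᵥ x) j‖ ≤ 1} ∩ {x | ‖w ⬝ᵥ x‖ ≤ 1}) =
        κ * ENNReal.ofReal (max 1 ‖S *ᵥ w‖)⁻¹ := by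
    intro w
    have hset : {x | ∀ j, ‖((Matrix.diagonal e * B) *ᵥ x) j‖ ≤ 1} ∩ {x | ‖w ⬝ᵥ x‖ ≤ 1} =
        (fun x => (Matrix.diagonal e * B) *ᵥ x) ⁻¹'
          {y | (∀ j, ‖y j‖ ≤ 1) ∧ ‖(S *ᵥ w) ⬝ᵥ y‖ ≤ 1} := by
      ext x
      have hx : (S *ᵥ w) ⬝ᵥ ((Matrix.diagonal e * B) *ᵥ x) = w ⬝ᵥ x := by
        rw [← Matrix.vecMul_transpose, ← Matrix.dotProduct_mulVec, Matrix.mulVec_mulVec, hST,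
          Matrix.one_mulVec]
      simp only [Set.mem_inter_iff, Set.mem_ofPred_eq, Set.mem_preimage, hx]
    have hm : MeasurableSet {y : Fin n → ℚ_[p] | (∀ j, ‖y j‖ ≤ 1) ∧ ‖(S *ᵥ w) ⬝ᵥ y‖ ≤ 1} :=
      hcube.inter (isClosed_le (f := fun y : Fin n → ℚ_[p] => ‖(S *ᵥ w) ⬝ᵥ y‖) (g := fun _ => 1)
        (by fun_prop) (by fun_prop)).measurableSet
    rw [hset, ← Measure.map_apply hTm hm, hmap, Measure.smul_apply, vecVol_halfspace, smul_eq_mul]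
  simp_rw [hinner, hvol, ENNReal.mul_rpow_of_nonneg _ _ hβ0.le]
  have hf : Measurable fun u : Fin n → ℚ_[p] => (ENNReal.ofReal (max 1 ‖u‖)⁻¹) ^ β := by
    have : Measurable fun u : Fin n → ℚ_[p] => max 1 ‖u‖ :=
      Continuous.measurable (by fun_prop)
    exact (this.inv.ennreal_ofReal).pow_const β
  have hSm : Measurable fun x : Fin n → ℚ_[p] => S *ᵥ x := Continuous.measurable (by fun_prop)
  have hfS : Measurable fun w : Fin n → ℚ_[p] => (ENNReal.ofReal (max 1 ‖S *ᵥ w‖)⁻¹) ^ β :=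
    hf.comp hSm
  rw [lintegral_const_mul _ hfS, ← lintegral_map (μ := vecVol p n) hf hSm, hmap',
    lintegral_smul_measure, lintegral_max_norm hβ, smul_eq_mul, ← mul_assoc,
    ENNReal.rpow_sub _ _ hκ0 hκt, ENNReal.rpow_one, div_eq_mul_inv]

/-! ### Part 4: `γ` as an inverse volume, and its behaviour under adding rows and columns -/

/-- The lattice of integral vectors `x` with `z x` integral. -/
def latt {m n : ℕ} (z : Matrix (Fin m) (Fin n) ℚ_[p]) : Set (Fin n → ℚ_[p]) :=
  {x | (∀ j, ‖x j‖ ≤ 1) ∧ ∀ i, ‖(z *ᵥ x) i‖ ≤ 1}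

/-- The volume of `latt z`. -/
noncomputable def del {m n : ℕ} (z : Matrix (Fin m) (Fin n) ℚ_[p]) : ℝ≥0∞ :=
  vecVol p n (latt z)

theorem measurableSet_latt {m n : ℕ} (z : Matrix (Fin m) (Fin n) ℚ_[p]) :
    MeasurableSet (latt z) :=
  (measurableSet_vecBox (f := fun x => x) (by fun_prop)).inter
    (measurableSet_vecBox (f := fun x => z *ᵥ x) (by fun_prop))

open Classical in
theorem IsSmith.latt_eq {n : ℕ} {z A B : Matrix (Fin n) (Fin n) ℚ_[p]} {d : Fin n → ℚ_[p]}
    (h : IsSmith z A d B) :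
    latt z = {x | ∀ j, ‖((Matrix.diagonal (fun j => if ‖d j‖ ≤ 1 then 1 else d j) * B) *ᵥ x) j‖
      ≤ 1} := by
  obtain ⟨hA, hB, -, rfl⟩ := h
  ext x
  simp only [latt, Set.mem_ofPred_eq]
  rw [← hB.mulVec_mem, ← Matrix.mulVec_mulVec, ← Matrix.mulVec_mulVec, hA.mulVec_mem,
    ← Matrix.mulVec_mulVec]
  simp only [Matrix.mulVec_diagonal]
  generalize B *ᵥ x = y
  rw [← forall_and]
  refine forall_congr' fun j => ?_
  split_ifs with h
  · rw [one_mul, norm_mul]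
    exact ⟨fun h => h.1, fun h1 => ⟨h1, mul_le_one₀ h (norm_nonneg _) h1⟩⟩
  · push Not at h
    refine ⟨fun h => h.2, fun h1 => ⟨le_trans ?_ h1, h1⟩⟩
    rw [norm_mul]
    exact le_mul_of_one_le_left (norm_nonneg _) h.le

theorem goodLattice_latt {n : ℕ} (z : Matrix (Fin n) (Fin n) ℚ_[p]) : GoodLattice (latt z) := by
  classical
  obtain ⟨A, d, B, h⟩ := exists_isSmith n z
  refine ⟨B, fun j => if ‖d j‖ ≤ 1 then 1 else d j, h.2.1, ?_, h.latt_eq⟩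
  intro j
  change (if ‖d j‖ ≤ 1 then 1 else d j) ≠ 0
  split_ifs with h
  · exact one_ne_zero
  · intro h0
    rw [h0, norm_zero] at h
    exact h zero_le_one

theorem IsSmith.del_eq {n : ℕ} {z A B : Matrix (Fin n) (Fin n) ℚ_[p]} {d : Fin n → ℚ_[p]}
    (h : IsSmith z A d B) : del z = ENNReal.ofReal (∏ j, max ‖d j‖ 1)⁻¹ := by
  classical
  have he : ∀ j, (if ‖d j‖ ≤ 1 then 1 else d j) ≠ 0 := by
    intro j
    split_ifs with h
    · exact one_ne_zero
    · intro h0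
      rw [h0, norm_zero] at h
      exact h zero_le_one
  have hcube : MeasurableSet {x : Fin n → ℚ_[p] | ∀ j, ‖x j‖ ≤ 1} :=
    measurableSet_vecBox (f := fun x => x) (by fun_prop)
  have hmap := map_diag_GL h.2.1 he
  have := congrArg (fun μ => μ {x : Fin n → ℚ_[p] | ∀ j, ‖x j‖ ≤ 1}) hmap
  simp only [Measure.smul_apply, vecVol_cube, smul_eq_mul, mul_one] at this
  rw [Measure.map_apply (Continuous.measurable (by fun_prop)) hcube] at this
  rw [del, h.latt_eq, ← Finset.prod_inv_distrib,
    ENNReal.ofReal_prod_of_nonneg (fun j _ => by positivity)]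
  refine this.trans (Finset.prod_congr rfl fun j _ => ?_)
  congr 2
  split_ifs with h
  · rw [max_eq_right h, norm_one]
  · rw [max_eq_left (not_le.mp h).le]

theorem gammaFn_spec {n : ℕ} (z : Matrix (Fin n) (Fin n) ℚ_[p]) :
    0 < gammaFn z ∧ del z = ENNReal.ofReal (gammaFn z)⁻¹ := by
  have h := exists_isSmith n z
  rw [gammaFn, dif_pos h]
  refine ⟨Finset.prod_pos fun j _ => by positivity, ?_⟩
  exact h.choose_spec.choose_spec.choose_spec.del_eq

theorem del_transpose {n : ℕ} (z : Matrix (Fin n) (Fin n) ℚ_[p]) : del zᵀ = del z := by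
  obtain ⟨A, d, B, h⟩ := exists_isSmith n z
  have h' : IsSmith zᵀ Bᵀ d Aᵀ := by
    obtain ⟨hA, hB, hd, rfl⟩ := h
    refine ⟨hB.transpose, hA.transpose, hd, ?_⟩
    simp [Matrix.transpose_mul, Matrix.mul_assoc]
  rw [h.del_eq, h'.del_eq]

/-- Append a row at the bottom. -/
def appendRow {m n : ℕ} (z : Matrix (Fin m) (Fin n) ℚ_[p]) (w : Fin n → ℚ_[p]) :
    Matrix (Fin (m + 1)) (Fin n) ℚ_[p] :=
  Matrix.of fun i j => Fin.lastCases (w j) (fun i' => z i' j) i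

/-- Append a column on the right. -/
def appendCol {m n : ℕ} (z : Matrix (Fin m) (Fin n) ℚ_[p]) (v : Fin m → ℚ_[p]) :
    Matrix (Fin m) (Fin (n + 1)) ℚ_[p] :=
  Matrix.of fun i j => Fin.lastCases (v i) (fun j' => z i j') j

@[simp] theorem appendRow_castSucc {m n : ℕ} (z : Matrix (Fin m) (Fin n) ℚ_[p])
    (w : Fin n → ℚ_[p]) (i : Fin m) (j : Fin n) : appendRow z w i.castSucc j = z i j := by
  simp [appendRow]

@[simp] theorem appendRow_last {m n : ℕ} (z : Matrix (Fin m) (Fin n) ℚ_[p])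
    (w : Fin n → ℚ_[p]) (j : Fin n) : appendRow z w (Fin.last m) j = w j := by
  simp [appendRow]

@[simp] theorem appendCol_castSucc {m n : ℕ} (z : Matrix (Fin m) (Fin n) ℚ_[p])
    (v : Fin m → ℚ_[p]) (i : Fin m) (j : Fin n) : appendCol z v i j.castSucc = z i j := by
  simp [appendCol]

@[simp] theorem appendCol_last {m n : ℕ} (z : Matrix (Fin m) (Fin n) ℚ_[p])
    (v : Fin m → ℚ_[p]) (i : Fin m) : appendCol z v i (Fin.last n) = v i := by
  simp [appendCol]

theorem latt_appendRow {m n : ℕ} (z : Matrix (Fin m) (Fin n) ℚ_[p]) (w : Fin n → ℚ_[p]) :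
    latt (appendRow z w) = latt z ∩ {x | ‖w ⬝ᵥ x‖ ≤ 1} := by
  ext x
  simp only [latt, Set.mem_ofPred_eq, Set.mem_inter_iff, Fin.forall_fin_succ', Matrix.mulVec,
    dotProduct, appendRow_castSucc, appendRow_last, and_assoc]

theorem latt_appendRow_zero {m n : ℕ} (z : Matrix (Fin m) (Fin n) ℚ_[p]) :
    latt (appendRow z 0) = latt z := by
  rw [latt_appendRow]; simp

theorem del_appendCol_zero {m n : ℕ} (z : Matrix (Fin m) (Fin n) ℚ_[p]) :
    del (appendCol z 0) = del z := by
  have hmp := measurePreserving_piFinSuccAbove (fun _ : Fin (n + 1) => lineVol p) (Fin.last n)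
  have hset : latt (appendCol z 0) =
      (MeasurableEquiv.piFinSuccAbove (fun _ : Fin (n + 1) => ℚ_[p]) (Fin.last n)) ⁻¹'
        (Metric.closedBall 0 1 ×ˢ latt z) := by
    ext x
    simp only [latt, Set.mem_ofPred_eq, Fin.forall_fin_succ', Matrix.mulVec, dotProduct,
      Set.mem_preimage, Set.mem_prod, mem_closedBall_zero_iff, Fin.sum_univ_castSucc,
      appendCol_castSucc, appendCol_last, MeasurableEquiv.piFinSuccAbove_apply,
      Fin.insertNthEquiv, Equiv.coe_fn_symm_mk, Fin.removeNth, Fin.succAbove_last, Pi.zero_apply,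
      zero_mul, add_zero]
    tauto
  rw [del, hset, vecVol, hmp.measure_preimage
    (Metric.isClosed_closedBall.measurableSet.prod (measurableSet_latt z)).nullMeasurableSet,
    Measure.prod_prod, lineVol_one, one_mul]
  rfl

theorem del_appendCol {n : ℕ} (z : Matrix (Fin n) (Fin n) ℚ_[p]) (v : Fin n → ℚ_[p]) :
    del (appendCol z v) = del (appendRow zᵀ v) := by
  have h1 : del (appendRow (appendCol z v) 0) = del (appendCol z v) := by
    rw [del, latt_appendRow_zero]; rfl
  have h2 : (appendRow (appendCol z v) 0)ᵀ = appendCol (appendRow zᵀ v) 0 := by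
    ext i j
    refine Fin.lastCases ?_ (fun i => ?_) i <;> refine Fin.lastCases ?_ (fun j => ?_) j <;> simp
  rw [← h1, ← del_transpose, h2, del_appendCol_zero]

theorem lintegral_lastRow {n : ℕ} (y : Matrix (Fin n) (Fin (n + 1)) ℚ_[p]) {β : ℝ}
    (hβ : ((n + 1 : ℕ) : ℝ) < β) :
    ∫⁻ w, del (appendRow y w) ^ β ∂(vecVol p (n + 1)) =
      del y ^ (β - 1) * rowConst p (n + 1) β := by
  have hg : GoodLattice (latt y) := by
    rw [← latt_appendRow_zero]; exact goodLattice_latt _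
  simp only [del, latt_appendRow]
  exact hg.lintegral_row hβ

theorem lintegral_lastCol {n : ℕ} (z : Matrix (Fin n) (Fin n) ℚ_[p]) {β : ℝ}
    (hβ : (n : ℝ) < β) :
    ∫⁻ v, del (appendCol z v) ^ β ∂(vecVol p n) = del z ^ (β - 1) * rowConst p n β := by
  simp only [del_appendCol]
  simp only [del, latt_appendRow]
  rw [(goodLattice_latt zᵀ).lintegral_row hβ, ← del, ← del, del_transpose]

theorem del_add_integral {m n : ℕ} (z h : Matrix (Fin m) (Fin n) ℚ_[p])
    (hh : ∀ i j, ‖h i j‖ ≤ 1) : del (z + h) = del z := by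
  rw [del, del]
  congr 1
  ext x
  simp only [latt, Set.mem_ofPred_eq, Matrix.add_mulVec, Pi.add_apply]
  refine and_congr_right fun hx => forall_congr' fun i => ?_
  have hi := norm_mulVec_le_one hh hx i
  constructor
  · intro h1
    have : (z *ᵥ x) i = ((z *ᵥ x) i + (h *ᵥ x) i) + -((h *ᵥ x) i) := by ring
    rw [this]
    exact (IsUltrametricDist.norm_add_le_max _ _).trans (max_le h1 (by rwa [norm_neg]))
  · intro h1
    exact (IsUltrametricDist.norm_add_le_max _ _).trans (max_le h1 hi)

theorem measurable_del {m n : ℕ} :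
    Measurable (del : Matrix (Fin m) (Fin n) ℚ_[p] → ℝ≥0∞) := by
  apply Continuous.measurable
  apply IsLocallyConstant.continuous
  rw [IsLocallyConstant.iff_exists_open]
  intro z
  refine ⟨{y | ∀ i j, ‖y i j - z i j‖ < 1}, ?_, by simp, ?_⟩
  · simp only [Set.ofPred_forall]
    refine isOpen_iInter_of_finite fun i => isOpen_iInter_of_finite fun j => ?_
    exact isOpen_lt (by fun_prop) (by fun_prop)
  · intro y hy
    have := del_add_integral z (y - z) (fun i j => (hy i j).le)
    rwa [add_sub_cancel] at this

/-! ### Part 5: constants -/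

theorem rowConst_eq {n : ℕ} {β : ℝ} (hβ : (n : ℝ) < β) :
    rowConst p n β = ENNReal.ofReal ((1 - (p : ℝ) ^ (-β)) / (1 - (p : ℝ) ^ ((n : ℝ) - β))) := by
  have hp := one_lt_prime_real (p := p)
  have hp0 : (0 : ℝ) < p := by linarith
  have hβ0 : 0 < β := lt_of_le_of_lt (Nat.cast_nonneg n) hβ
  have h1 : (p : ℝ) ^ ((n : ℝ) - β) < 1 := Real.rpow_lt_one_of_one_lt_of_neg hp (by linarith)
  have hc : ∀ t : ℝ, (p : ℝ≥0∞) ^ t = ENNReal.ofReal ((p : ℝ) ^ t) := by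
    intro t
    rw [← ENNReal.ofReal_rpow_of_pos hp0, ENNReal.ofReal_natCast]
  have hs : ∀ t : ℝ, 1 - (p : ℝ≥0∞) ^ t = ENNReal.ofReal (1 - (p : ℝ) ^ t) := by
    intro t
    rw [hc, ENNReal.ofReal_sub _ (by positivity), ENNReal.ofReal_one]
  rw [rowConst, hs, hs, ENNReal.ofReal_div_of_pos (by linarith), div_eq_mul_inv]

theorem cConst_eq (n : ℕ) (s : ℝ) :
    cConst p n (s + 2 * n) =
      (∏ j ∈ Finset.range n, (1 - (p : ℝ) ^ (-s - (n + j + 1 : ℕ)))) /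
        ∏ j ∈ Finset.range n, (1 - (p : ℝ) ^ (-s - (j + 1 : ℕ))) := by
  rw [cConst, Finset.prod_div_distrib]
  congr 1
  · refine Finset.prod_congr rfl fun j _ => ?_
    congr 2; push_cast; ring
  · rw [← Finset.prod_range_reflect]
    refine Finset.prod_congr rfl fun j hj => ?_
    have hj' : j + 1 ≤ n := Finset.mem_range.mp hj
    congr 2
    have : ((n - 1 - j : ℕ) : ℝ) = n - 1 - j := by
      rw [Nat.sub_sub, Nat.cast_sub (by lia)]; push_cast; ring
    rw [Nat.cast_add, this]; push_cast; ring

theorem factor_pos {s : ℝ} (hs : -1 < s) (k : ℕ) : 0 < 1 - (p : ℝ) ^ (-s - (k + 1 : ℕ)) := by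
  have := Real.rpow_lt_one_of_one_lt_of_neg (one_lt_prime_real (p := p))
    (z := -s - (k + 1 : ℕ)) (by push_cast; have : (0 : ℝ) ≤ k := Nat.cast_nonneg k; linarith)
  linarith

theorem cConst_pos (n : ℕ) {s : ℝ} (hs : -1 < s) : 0 < cConst p n (s + 2 * n) := by
  rw [cConst_eq]
  exact div_pos (Finset.prod_pos fun j _ => factor_pos hs _)
    (Finset.prod_pos fun j _ => factor_pos hs _)

theorem cConst_succ (n : ℕ) {s : ℝ} (hs : -1 < s) :
    cConst p (n + 1) (s + 2 * (n + 1 : ℕ)) = cConst p n (s + 2 * n) *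
      ((1 - (p : ℝ) ^ (-(s + 2 * (n + 1 : ℕ)))) /
        (1 - (p : ℝ) ^ (((n + 1 : ℕ) : ℝ) - (s + 2 * (n + 1 : ℕ))))) *
      ((1 - (p : ℝ) ^ (-(s + 2 * (n + 1 : ℕ) - 1))) /
        (1 - (p : ℝ) ^ ((n : ℝ) - (s + 2 * (n + 1 : ℕ) - 1)))) := by
  set f : ℕ → ℝ := fun k => 1 - (p : ℝ) ^ (-s - (k + 1 : ℕ)) with hf
  have hfpos : ∀ k, 0 < f k := fun k => factor_pos hs k
  have e1 : (1 - (p : ℝ) ^ (-(s + 2 * (n + 1 : ℕ)))) = f (n + n + 1) := by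
    simp only [hf]; congr 2; push_cast; ring
  have e2 : (1 - (p : ℝ) ^ (((n + 1 : ℕ) : ℝ) - (s + 2 * (n + 1 : ℕ)))) = f n := by
    simp only [hf]; congr 2; push_cast; ring
  have e3 : (1 - (p : ℝ) ^ (-(s + 2 * (n + 1 : ℕ) - 1))) = f (n + n) := by
    simp only [hf]; congr 2; push_cast; ring
  have e4 : (1 - (p : ℝ) ^ ((n : ℝ) - (s + 2 * (n + 1 : ℕ) - 1))) = f n := by
    simp only [hf]; congr 2; push_cast; ring
  rw [e1, e2, e3, e4, cConst_eq, cConst_eq]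
  have hN : (∏ j ∈ Finset.range (n + 1), f (n + 1 + j)) * f n =
      (∏ j ∈ Finset.range n, f (n + j)) * f (n + n) * f (n + n + 1) := by
    have h1 := Finset.prod_range_succ' (fun j => f (n + j)) (n + 1)
    have h2 := Finset.prod_range_succ (fun j => f (n + j)) (n + 1)
    rw [h2, Finset.prod_range_succ] at h1
    simp only [add_zero] at h1
    rw [show n + n + 1 = n + (n + 1) by ring, h1]
    congr 1
    exact Finset.prod_congr rfl fun j _ => by congr 1; ring
  have hD := Finset.prod_range_succ f n
  have hDpos : 0 < ∏ j ∈ Finset.range n, f j := Finset.prod_pos fun j _ => hfpos j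
  change (∏ j ∈ Finset.range (n + 1), f (n + 1 + j)) / (∏ j ∈ Finset.range (n + 1), f j) =
    (∏ j ∈ Finset.range n, f (n + j)) / (∏ j ∈ Finset.range n, f j) * (f (n + n + 1) / f n) *
      (f (n + n) / f n)
  rw [hD]
  have := (hfpos n).ne'
  have := hDpos.ne'
  field_simp
  linear_combination hN

/-! ### Part 6: the decomposition of the Haar measure and the final computation -/

theorem lintegral_decomp (n : ℕ)
    (vol' : Measure (Matrix (Fin (n + 1)) (Fin (n + 1)) ℚ_[p])) [vol'.IsAddHaarMeasure]
    (hnorm' : vol' {z : Matrix (Fin (n + 1)) (Fin (n + 1)) ℚ_[p] | ∀ i j, ‖z i j‖ ≤ 1} = 1)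
    (vol : Measure (Matrix (Fin n) (Fin n) ℚ_[p])) [vol.IsAddHaarMeasure]
    (hnorm : vol {z : Matrix (Fin n) (Fin n) ℚ_[p] | ∀ i j, ‖z i j‖ ≤ 1} = 1)
    (g : Matrix (Fin (n + 1)) (Fin (n + 1)) ℚ_[p] → ℝ≥0∞) (hg : Measurable g) :
    ∫⁻ M, g M ∂vol' = ∫⁻ z, ∫⁻ v, ∫⁻ w, g (appendRow (appendCol z v) w)
      ∂(vecVol p (n + 1)) ∂(vecVol p n) ∂vol := by
  have : SecondCountableTopology (Matrix (Fin n) (Fin n) ℚ_[p]) :=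
    inferInstanceAs (SecondCountableTopology (Fin n → Fin n → ℚ_[p]))
  have : SecondCountableTopology (Matrix (Fin (n + 1)) (Fin (n + 1)) ℚ_[p]) :=
    inferInstanceAs (SecondCountableTopology (Fin (n + 1) → Fin (n + 1) → ℚ_[p]))
  have : LocallyCompactSpace (Matrix (Fin n) (Fin n) ℚ_[p]) :=
    inferInstanceAs (LocallyCompactSpace (Fin n → Fin n → ℚ_[p]))
  have : LocallyCompactSpace (Matrix (Fin (n + 1)) (Fin (n + 1)) ℚ_[p]) :=
    inferInstanceAs (LocallyCompactSpace (Fin (n + 1) → Fin (n + 1) → ℚ_[p]))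
  have : SigmaFinite vol := inferInstance
  let E : (Matrix (Fin n) (Fin n) ℚ_[p] × ((Fin n → ℚ_[p]) × (Fin (n + 1) → ℚ_[p]))) ≃+
      Matrix (Fin (n + 1)) (Fin (n + 1)) ℚ_[p] :=
    { toFun := fun t => appendRow (appendCol t.1 t.2.1) t.2.2
      invFun := fun M => (M.submatrix Fin.castSucc Fin.castSucc,
        (fun i => M i.castSucc (Fin.last n)), fun j => M (Fin.last n) j)
      left_inv := fun t => by
        refine Prod.ext ?_ (Prod.ext ?_ ?_)
        · ext i j; simp
        · ext i; simp
        · ext i; simp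
      right_inv := fun M => by
        ext i j
        refine Fin.lastCases ?_ (fun i => ?_) i <;> refine Fin.lastCases ?_ (fun j => ?_) j <;> simp
      map_add' := fun a b => by
        ext i j
        refine Fin.lastCases ?_ (fun i => ?_) i <;>
          refine Fin.lastCases ?_ (fun j => ?_) j <;> simp }
  have hE : Continuous E := by
    refine continuous_matrix fun i j => ?_
    refine Fin.lastCases ?_ (fun i => ?_) i <;> refine Fin.lastCases ?_ (fun j => ?_) j <;>
      simp only [E, AddEquiv.coe_mk, Equiv.coe_fn_mk, appendRow_castSucc, appendRow_last,
        appendCol_castSucc, appendCol_last] <;> fun_prop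
  have hE' : Continuous E.symm := by
    change Continuous fun M : Matrix (Fin (n + 1)) (Fin (n + 1)) ℚ_[p] =>
      (M.submatrix Fin.castSucc Fin.castSucc,
        (fun i : Fin n => M i.castSucc (Fin.last n)), fun j => M (Fin.last n) j)
    fun_prop
  set π := vol.prod ((vecVol p n).prod (vecVol p (n + 1))) with hπ
  have : π.IsAddHaarMeasure := by
    have h2 : ((vecVol p n).prod (vecVol p (n + 1))).IsAddHaarMeasure := inferInstance
    rw [hπ]
    exact Measure.prod.instIsAddHaarMeasure vol _
  have : (π.map E).IsAddHaarMeasure := E.isAddHaarMeasure_map π hE hE'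
  have hcubeM : MeasurableSet
      {z : Matrix (Fin (n + 1)) (Fin (n + 1)) ℚ_[p] | ∀ i j, ‖z i j‖ ≤ 1} := by
    simp only [Set.ofPred_forall]
    refine MeasurableSet.iInter fun i => MeasurableSet.iInter fun j => ?_
    exact (isClosed_le (by fun_prop) (by fun_prop)).measurableSet
  have hpre : E ⁻¹' {z : Matrix (Fin (n + 1)) (Fin (n + 1)) ℚ_[p] | ∀ i j, ‖z i j‖ ≤ 1} =
      {z : Matrix (Fin n) (Fin n) ℚ_[p] | ∀ i j, ‖z i j‖ ≤ 1} ×ˢ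
        ({v : Fin n → ℚ_[p] | ∀ i, ‖v i‖ ≤ 1} ×ˢ {w : Fin (n + 1) → ℚ_[p] | ∀ i, ‖w i‖ ≤ 1}) := by
    ext ⟨z, v, w⟩
    simp only [E, Set.mem_preimage, Set.mem_ofPred_eq, Set.mem_prod, AddEquiv.coe_mk,
      Equiv.coe_fn_mk]
    rw [Fin.forall_fin_succ']
    simp only [appendRow_castSucc, appendRow_last]
    rw [← and_assoc]
    refine and_congr_left fun _ => ?_
    simp only [Fin.forall_fin_succ', appendCol_castSucc, appendCol_last, forall_and]
  have hvol' : vol' = π.map E := by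
    have h := haar_eq_smul_of_one (π.map E) vol' _ hnorm'
    rw [Measure.map_apply hE.measurable hcubeM, hpre, hπ, Measure.prod_prod, Measure.prod_prod,
      hnorm, vecVol_cube, vecVol_cube, one_mul, one_mul, one_smul] at h
    exact h.symm
  have hgE : Measurable fun t => g (E t) := hg.comp hE.measurable
  rw [hvol', lintegral_map hg hE.measurable, hπ, lintegral_prod _ hgE.aemeasurable]
  refine lintegral_congr fun z => ?_
  have hgz : Measurable fun t : (Fin n → ℚ_[p]) × (Fin (n + 1) → ℚ_[p]) => g (E (z, t)) :=
    hgE.comp measurable_prodMk_left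
  rw [lintegral_prod _ hgz.aemeasurable]
  rfl

theorem density_eq (n : ℕ) {s : ℝ} (hs : -1 < s) (z : Matrix (Fin n) (Fin n) ℚ_[p]) :
    ENNReal.ofReal ((cConst p n (s + 2 * n))⁻¹ * gammaFn z ^ (-(s + 2 * n))) =
      ENNReal.ofReal (cConst p n (s + 2 * n))⁻¹ * del z ^ (s + 2 * n) := by
  obtain ⟨h1, h2⟩ := gammaFn_spec z
  rw [ENNReal.ofReal_mul (inv_nonneg.mpr (cConst_pos n hs).le), h2,
    ENNReal.ofReal_rpow_of_pos (inv_pos.mpr h1), Real.inv_rpow h1.le, Real.rpow_neg h1.le]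

/-- the pushforward of `μ_s^{n+1}` under the corner map
`[[z₁₁, z₁₂],[z₂₁, z₂₂]] ↦ z₁₁` equals `μ_s^n`. -/
theorem map_corner_huaMeasure (n : ℕ)
    (vol' : Measure (Matrix (Fin (n + 1)) (Fin (n + 1)) ℚ_[p])) [vol'.IsAddHaarMeasure]
    (hnorm' : vol' {z : Matrix (Fin (n + 1)) (Fin (n + 1)) ℚ_[p] | ∀ i j, ‖z i j‖ ≤ 1} = 1)
    (vol : Measure (Matrix (Fin n) (Fin n) ℚ_[p])) [vol.IsAddHaarMeasure]
    (hnorm : vol {z : Matrix (Fin n) (Fin n) ℚ_[p] | ∀ i j, ‖z i j‖ ≤ 1} = 1)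
    (s : ℝ) (hs : -1 < s) :
    Measure.map
        (fun z : Matrix (Fin (n + 1)) (Fin (n + 1)) ℚ_[p] =>
          z.submatrix (Fin.castSucc) (Fin.castSucc))
        (huaMeasure p (n + 1) s vol') = huaMeasure p n s vol := by
  have hcorner : Measurable fun z : Matrix (Fin (n + 1)) (Fin (n + 1)) ℚ_[p] =>
      z.submatrix (Fin.castSucc) (Fin.castSucc) := by
    refine measurable_pi_lambda _ fun i => measurable_pi_lambda _ fun j => ?_
    exact (measurable_pi_apply j.castSucc).comp (measurable_pi_apply i.castSucc)
  have hn0 : (0 : ℝ) ≤ n := Nat.cast_nonneg n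
  set β : ℝ := s + 2 * (n + 1 : ℕ) with hβ
  have hβ1 : ((n + 1 : ℕ) : ℝ) < β := by rw [hβ]; push_cast; linarith
  have hβ2 : (n : ℝ) < β - 1 := by rw [hβ]; push_cast; linarith
  set K' := ENNReal.ofReal (cConst p (n + 1) β)⁻¹ with hK'
  set K := ENNReal.ofReal (cConst p n (s + 2 * n))⁻¹ with hK
  have hconst : K' * (rowConst p (n + 1) β * rowConst p n (β - 1)) = K := by
    have hc' := cConst_pos (p := p) (n + 1) hs
    have hc := cConst_pos (p := p) n hs
    have hrec := cConst_succ (p := p) n hs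
    rw [← hβ] at hrec hc'
    rw [hK', hK, rowConst_eq hβ1, rowConst_eq hβ2]
    set R1 := (1 - (p : ℝ) ^ (-β)) / (1 - (p : ℝ) ^ (((n + 1 : ℕ) : ℝ) - β))
    set R2 := (1 - (p : ℝ) ^ (-(β - 1))) / (1 - (p : ℝ) ^ ((n : ℝ) - (β - 1)))
    have hp := one_lt_prime_real (p := p)
    have hneg : ∀ t : ℝ, t < 0 → 0 < 1 - (p : ℝ) ^ t := fun t ht => by
      linarith [Real.rpow_lt_one_of_one_lt_of_neg hp ht]
    have hR1 : 0 < R1 := div_pos (hneg _ (by linarith)) (hneg _ (by linarith))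
    have hR2 : 0 < R2 := div_pos (hneg _ (by linarith)) (hneg _ (by linarith))
    rw [← ENNReal.ofReal_mul hR1.le, ← ENNReal.ofReal_mul (inv_nonneg.mpr hc'.le), hrec]
    congr 1
    field_simp
  ext S hS
  rw [Measure.map_apply hcorner hS, huaMeasure, huaMeasure,
    withDensity_apply _ (hcorner hS), withDensity_apply _ hS,
    ← lintegral_indicator (hcorner hS), ← lintegral_indicator hS]
  simp only [density_eq _ hs]
  rw [lintegral_decomp n vol' hnorm' vol hnorm _
    (((measurable_del.pow_const _).const_mul _).indicator (hcorner hS))]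
  refine lintegral_congr fun z => ?_
  have hsub : ∀ v w, (appendRow (appendCol z v) w).submatrix Fin.castSucc Fin.castSucc = z := by
    intro v w; ext i j; simp
  by_cases hz : z ∈ S
  · rw [Set.indicator_of_mem hz]
    have h1 : ∀ v w, Set.indicator ((fun z : Matrix (Fin (n + 1)) (Fin (n + 1)) ℚ_[p] =>
        z.submatrix (Fin.castSucc) (Fin.castSucc)) ⁻¹' S)
        (fun M => K' * del M ^ β) (appendRow (appendCol z v) w) =
        K' * del (appendRow (appendCol z v) w) ^ β := by
      intro v w
      exact Set.indicator_of_mem (by rw [Set.mem_preimage, hsub]; exact hz) _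
    simp only [← hβ, ← hK', ← hK]
    simp only [h1]
    have hKt : K' ≠ ⊤ := ENNReal.ofReal_ne_top
    have hRt : ∀ (m : ℕ) (b : ℝ), (m : ℝ) < b → rowConst p m b ≠ ⊤ := fun m b hb => by
      rw [rowConst_eq hb]; exact ENNReal.ofReal_ne_top
    simp only [lintegral_const_mul' _ _ hKt, lintegral_lastRow _ hβ1,
      lintegral_mul_const' _ _ (hRt _ _ hβ1), lintegral_lastCol _ hβ2]
    rw [← hconst, show β - 1 - 1 = s + 2 * n by rw [hβ]; push_cast; ring]
    ring
  · rw [Set.indicator_of_notMem hz]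
    have h1 : ∀ (F : Matrix (Fin (n + 1)) (Fin (n + 1)) ℚ_[p] → ℝ≥0∞) v w,
        Set.indicator ((fun z : Matrix (Fin (n + 1)) (Fin (n + 1)) ℚ_[p] =>
        z.submatrix (Fin.castSucc) (Fin.castSucc)) ⁻¹' S)
        F (appendRow (appendCol z v) w) = 0 := by
      intro F v w
      exact Set.indicator_of_notMem (by rw [Set.mem_preimage, hsub]; exact hz) _
    simp only [h1, lintegral_zero]
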